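/- arXiv:2306.09292 — 2 statements merged into one kernel-verified Lean document; each statement's English description precedes it below -/
import Mathlib

section
/- Convolution-multiplication duality for qubits: for K = 2N+1 n-qubit states ρ_1,...,ρ_K, the characteristic function of their convolution satisfies Ξ_{⊠_K(⊗ρ_i)}(p⃗,q⃗) = (-1)^{N p⃗·q⃗} ∏_{j=1}^K Ξ_{ρ_j}(p⃗,q⃗) for all (p⃗,q⃗) ∈ Z_2^n × Z_2^n. -/
open Matrix Finset
open scoped ComplexOrder

variable {G : Type*} [AddCommGroup G] [Fintype G] [DecidableEq G]

/-- The key unitary of the `(m+1)`-fold qubit convolution, as a permutation of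
computational basis labels: `(x₁,…,x_K) ↦ (Σᵢ xᵢ, x₂+x₁, …, x_K+x₁)`. -/
def keyFun (m : ℕ) (t : Fin (m + 1) → G) : Fin (m + 1) → G :=
  fun i => if i = 0 then ∑ j, t j else t i + t 0

/-- The key unitary `V` (a permutation matrix built from CNOT gates). -/
def keyU (m : ℕ) : Matrix (Fin (m + 1) → G) (Fin (m + 1) → G) ℂ :=
  Matrix.of fun x y => if x = keyFun m y then 1 else 0

/-- The tensor product `ρ₁ ⊗ ⋯ ⊗ ρ_K` of `K = m+1` states. -/
def bigTensor (m : ℕ) (ρ : Fin (m + 1) → Matrix G G ℂ) :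
    Matrix (Fin (m + 1) → G) (Fin (m + 1) → G) ℂ :=
  Matrix.of fun x y => ∏ i, ρ i (x i) (y i)

/-- Partial trace over subsystems `2, …, K`, keeping the first subsystem. -/
noncomputable def ptraceFirst (m : ℕ)
    (M : Matrix (Fin (m + 1) → G) (Fin (m + 1) → G) ℂ) : Matrix G G ℂ :=
  Matrix.of fun a b =>
    ∑ r : {i : Fin (m + 1) // i ≠ 0} → G,
      M (fun i => if h : i = 0 then a else r ⟨i, h⟩)
        (fun i => if h : i = 0 then b else r ⟨i, h⟩)

/-- The `K = m+1`-fold quantum convolution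
`⊠_K(ρ₁ ⊗ ⋯ ⊗ ρ_K) = Tr_{2,…,K}(V (ρ₁⊗⋯⊗ρ_K) V†)`. -/
noncomputable def qconv (m : ℕ) (ρ : Fin (m + 1) → Matrix G G ℂ) : Matrix G G ℂ :=
  ptraceFirst m (keyU m * bigTensor m ρ * (keyU m)ᴴ)

/-- A quantum state: positive semidefinite with unit trace. -/
def IsState (ρ : Matrix G G ℂ) : Prop := ρ.PosSemidef ∧ ρ.trace = 1

/-- Qubit shift operator. -/
def pauliX : Matrix (ZMod 2) (ZMod 2) ℂ :=
  Matrix.of fun k l => if k = l + 1 then 1 else 0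

/-- Qubit phase operator. -/
def pauliZ : Matrix (ZMod 2) (ZMod 2) ℂ :=
  Matrix.of fun k l => if k = l then (-1 : ℂ) ^ (k.val) else 0

/-- Qubit Pauli operator `w(p,q) = i^{-pq} Z^p X^q`. -/
noncomputable def pauliW (p q : ZMod 2) : Matrix (ZMod 2) (ZMod 2) ℂ :=
  Complex.I ^ (-(p.val * q.val : ℤ)) • (pauliZ ^ p.val * pauliX ^ q.val)

/-- `n`-qubit Pauli operator `w(p⃗,q⃗)`. -/
noncomputable def pauliWn (n : ℕ)
    (pq : (Fin n → ZMod 2) × (Fin n → ZMod 2)) :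
    Matrix (Fin n → ZMod 2) (Fin n → ZMod 2) ℂ :=
  Matrix.of fun a b => ∏ k, pauliW (pq.1 k) (pq.2 k) (a k) (b k)

/-- Characteristic function `Ξ_ρ(p⃗,q⃗) = Tr(ρ w(-p⃗,-q⃗))` of an `n`-qubit
operator. -/
noncomputable def charFn {n : ℕ}
    (ρ : Matrix (Fin n → ZMod 2) (Fin n → ZMod 2) ℂ)
    (pq : (Fin n → ZMod 2) × (Fin n → ZMod 2)) : ℂ :=
  (ρ * pauliWn n (-pq.1, -pq.2)).trace

theorem pauliZ_pow_apply (p a b : ZMod 2) :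
    (pauliZ ^ p.val) a b = if a = b then (-1 : ℂ) ^ (p.val * a.val) else 0 := by
  rcases (by decide : ∀ x : ZMod 2, x = 0 ∨ x = 1) p with rfl | rfl
  · simp [Matrix.one_apply]
  · simp [pauliZ, ZMod.val_one]

theorem pauliX_pow_apply (q a b : ZMod 2) :
    (pauliX ^ q.val) a b = if b = a + q then 1 else 0 := by
  rcases (by decide : ∀ x : ZMod 2, x = 0 ∨ x = 1) q with rfl | rfl
  · simp [Matrix.one_apply, eq_comm]
  · have h : a = b + 1 ↔ b = a + 1 := by decide +revert
    simp [pauliX, ZMod.val_one, h]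

theorem pauliW_apply (p q a b : ZMod 2) :
    pauliW p q a b =
      if b = a + q then Complex.I ^ (-(p.val * q.val : ℤ)) * (-1) ^ (p.val * a.val) else 0 := by
  rw [pauliW, Matrix.smul_apply, Matrix.mul_apply, Fintype.sum_eq_single a fun x hx => by
    rw [pauliZ_pow_apply, if_neg hx.symm, zero_mul]]
  simp [pauliZ_pow_apply, pauliX_pow_apply]

/-- The character `x ↦ (-1)^{p⃗·x⃗}` of `Z_2^n`. -/
noncomputable def signChar {n : ℕ} (p : Fin n → ZMod 2) : AddChar (Fin n → ZMod 2) ℂ where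
  toFun x := ∏ k, (-1 : ℂ) ^ ((p k).val * (x k).val)
  map_zero_eq_one' := by simp
  map_add_eq_mul' x y := by
    rw [← Finset.prod_mul_distrib]
    refine Finset.prod_congr rfl fun k _ => ?_
    rw [Pi.add_apply, ZMod.val_add, pow_mul', ← neg_one_pow_eq_pow_mod_two, pow_add, mul_pow,
      ← pow_mul', ← pow_mul']

/-- The phase `i^{-p⃗·q⃗}` of the Pauli operator `w(p⃗,q⃗)`. -/
noncomputable def pauliPhase {n : ℕ} (p q : Fin n → ZMod 2) : ℂ :=
  ∏ k, Complex.I ^ (-((p k).val * (q k).val : ℤ))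

theorem pauliWn_apply {n : ℕ} (p q a b : Fin n → ZMod 2) :
    pauliWn n (p, q) a b = if b = a + q then pauliPhase p q * signChar p a else 0 := by
  simp only [pauliWn, Matrix.of_apply, pauliW_apply]
  split_ifs with hb
  · simp only [pauliPhase, signChar, AddChar.coe_mk]
    rw [← Finset.prod_mul_distrib]
    exact Finset.prod_congr rfl fun k _ => if_pos (congrFun hb k)
  · obtain ⟨k, hk⟩ := Function.ne_iff.mp hb
    exact Finset.prod_eq_zero (Finset.mem_univ k) (if_neg hk)

theorem charFn_eq_sum {n : ℕ} (ρ : Matrix (Fin n → ZMod 2) (Fin n → ZMod 2) ℂ)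
    (pq : (Fin n → ZMod 2) × (Fin n → ZMod 2)) :
    charFn ρ pq =
      pauliPhase pq.1 pq.2 * ∑ s, ρ s (s + pq.2) * signChar pq.1 (s + pq.2) := by
  obtain ⟨p, q⟩ := pq
  have hneg (x : Fin n → ZMod 2) : -x = x := funext fun k => ZMod.neg_eq_self_mod_two _
  have hadd (s b : Fin n → ZMod 2) : s = b + q ↔ b = s + q := by
    rw [← sub_eq_iff_eq_add, sub_eq_add_neg, hneg, eq_comm]
  simp only [charFn, Matrix.trace, Matrix.diag_apply, Matrix.mul_apply, hneg, pauliWn_apply, hadd,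
    mul_ite, mul_zero, Finset.sum_ite_eq', Finset.mem_univ, if_true,
    Finset.mul_sum]
  exact Finset.sum_congr rfl fun s _ => by ring

theorem keyFun_add_const {A : Type*} [AddCommGroup A] (h2 : ∀ x : A, x + x = 0) (N : ℕ)
    (t : Fin (2 * N + 1) → A) (q : A) :
    keyFun (2 * N) (fun i => t i + q) = fun i => if i = 0 then keyFun (2 * N) t 0 + q else
      keyFun (2 * N) t i := by
  funext i
  by_cases hi : i = 0
  · simp [keyFun, hi, Finset.sum_add_distrib, add_smul, mul_comm 2 N, mul_smul, two_nsmul, h2]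
  · simp only [keyFun, hi, if_false]
    rw [add_add_add_comm, h2, add_zero]

theorem keyFun_bijective {A : Type*} [AddCommGroup A] [Finite A] (h2 : ∀ x : A, x + x = 0)
    (N : ℕ) :
    Function.Bijective (keyFun (G := A) (2 * N)) := by
  rw [← Finite.injective_iff_bijective]
  intro s t h
  have hconst : s = fun i => t i + (s 0 - t 0) := by
    funext i
    by_cases hi : i = 0
    · simp [hi]
    · have := congrFun h i
      simp only [keyFun, hi, if_false] at this
      have hs := h2 (s 0)
      have ht := h2 (t 0)
      have hs' : s 0 = - s 0 := eq_neg_of_add_eq_zero_left hs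
      have ht' : t 0 = - t 0 := eq_neg_of_add_eq_zero_left ht
      rw [← eq_sub_iff_add_eq] at this
      rw [this, hs', ht']
      nth_rw 1 [ht']
      nth_rw 1 [hs']
      abel
  have h0 := congrFun h 0
  rw [hconst, keyFun_add_const h2] at h0
  rw [hconst]
  simp only [if_true, add_eq_left] at h0
  simp [h0]

theorem keyU_conj_apply {m : ℕ} (hk : Function.Injective (keyFun (G := G) m))
    (M : Matrix (Fin (m + 1) → G) (Fin (m + 1) → G) ℂ) (s t : Fin (m + 1) → G) :
    (keyU m * M * (keyU m)ᴴ : Matrix (Fin (m + 1) → G) (Fin (m + 1) → G) ℂ) (keyFun m s)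
        (keyFun m t) = M s t := by
  simp [keyU, Matrix.mul_apply, Matrix.conjTranspose_apply, hk.eq_iff]

theorem sum_ptraceFirst {A : Type*} [AddCommGroup A] [Fintype A] {m : ℕ}
    (M : Matrix (Fin (m + 1) → A) (Fin (m + 1) → A) ℂ) (q : A)
    (f : A → ℂ) :
    ∑ a, ptraceFirst m M a (a + q) * f (a + q) =
      ∑ x : Fin (m + 1) → A, M x (fun i => if i = 0 then x 0 + q else x i) * f (x 0 + q) := by
  simp only [ptraceFirst, Matrix.of_apply, Finset.sum_mul]
  rw [← Fintype.sum_prod_type',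
    ← (Equiv.funSplitAt (0 : Fin (m + 1)) A).symm.sum_comp]
  refine Finset.sum_congr rfl fun x _ => ?_
  congr 2
  all_goals
    funext i
    by_cases hi : i = 0 <;> simp [Equiv.funSplitAt, Equiv.piSplitAt, hi]

theorem prod_addChar {A : Type*} [AddCommGroup A] {ι : Type*} (χ : AddChar A ℂ)
    (S : Finset ι) (f : ι → A) :
    ∏ i ∈ S, χ (f i) = χ (∑ i ∈ S, f i) :=
  (map_prod χ.toMonoidHom (fun i => Multiplicative.ofAdd (f i)) S).symm

theorem sum_qconv (h2 : ∀ x : G, x + x = 0) (N : ℕ) (ρ : Fin (2 * N + 1) → Matrix G G ℂ) (q : G)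
    (χ : AddChar G ℂ) :
    ∑ a, qconv (2 * N) ρ a (a + q) * χ (a + q) = ∏ i, ∑ s, ρ i s (s + q) * χ (s + q) := by
  have hk := keyFun_bijective h2 N
  rw [qconv, sum_ptraceFirst, ← hk.sum_comp, Finset.prod_univ_sum, Fintype.piFinset_univ]
  refine Finset.sum_congr rfl fun s _ => ?_
  rw [← keyFun_add_const h2, keyU_conj_apply hk.injective, Finset.prod_mul_distrib,
    prod_addChar]
  congr 2
  have := congrFun (keyFun_add_const h2 N s q) 0
  simpa [keyFun] using this.symm

theorem pauliPhase_pow {n : ℕ} (N : ℕ) (p q : Fin n → ZMod 2) :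
    pauliPhase p q ^ (2 * N + 1) =
      (-1) ^ (N * ∑ j, (p j).val * (q j).val) * pauliPhase p q := by
  have h : pauliPhase p q ^ 2 = (-1) ^ ∑ j, (p j).val * (q j).val := by
    rw [pauliPhase, ← Finset.prod_pow, ← Finset.prod_pow_eq_pow_sum]
    refine Finset.prod_congr rfl fun k _ => ?_
    rw [← Nat.cast_mul, _root_.zpow_neg, zpow_natCast, inv_pow, ← pow_mul, mul_comm, pow_mul,
      Complex.I_sq, ← inv_pow, inv_neg_one]
  rw [pow_succ, pow_mul, h, ← pow_mul, mul_comm N]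

/-- **Convolution–multiplication duality for qubits:** for `K = 2N+1` `n`-qubit
states `ρ₁,…,ρ_K`, `Ξ_{⊠_K(⊗ρᵢ)}(p⃗,q⃗) = (-1)^{N p⃗·q⃗} ∏ⱼ Ξ_{ρⱼ}(p⃗,q⃗)`. -/
theorem charFn_qconv (n N : ℕ)
    (ρ : Fin (2 * N + 1) → Matrix (Fin n → ZMod 2) (Fin n → ZMod 2) ℂ)
    (hρ : ∀ i, IsState (ρ i))
    (pq : (Fin n → ZMod 2) × (Fin n → ZMod 2)) :
    charFn (qconv (2 * N) ρ) pq =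
      (-1 : ℂ) ^ (N * ∑ j, (pq.1 j).val * (pq.2 j).val) *
        ∏ i, charFn (ρ i) pq := by
  have h2 (x : Fin n → ZMod 2) : x + x = 0 := funext fun k => CharTwo.add_self_eq_zero (x k)
  simp only [charFn_eq_sum, Finset.prod_mul_distrib, Finset.prod_const, Finset.card_univ,
    Fintype.card_fin]
  rw [sum_qconv h2, pauliPhase_pow, ← mul_assoc, ← mul_assoc, ← pow_add,
    Even.neg_one_pow (Even.add_self _), one_mul]
end

section
/- Majorization under convolution: if ρ_1, ρ_2, ρ_3 are n-qubit states with eigenvalue vectors λ⃗_1, λ⃗_2, λ⃗_3, then the eigenvalue vector of ⊠_3(ρ_1⊗ρ_2⊗ρ_3) is majorized by each λ⃗_j, j = 1,2,3. -/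
open Matrix Finset
open scoped ComplexOrder

variable {G : Type*} [AddCommGroup G] [Fintype G] [DecidableEq G]

/-- `v` is majorized by `w`: every partial sum of `v` (over any index set) is
dominated by a partial sum of `w` of the same size, and the totals agree. -/
def Majorized {ι : Type*} [Fintype ι] (v w : ι → ℝ) : Prop :=
  (∀ A : Finset ι, ∃ B : Finset ι,
      B.card = A.card ∧ ∑ i ∈ A, v i ≤ ∑ i ∈ B, w i) ∧
    ∑ i, v i = ∑ i, w i

theorem Majorized.of_mulVec {ι : Type*} [Fintype ι] [DecidableEq ι] {D : Matrix ι ι ℝ}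
    (hD : D ∈ doublyStochastic ℝ ι) (w : ι → ℝ) : Majorized (D *ᵥ w) w := by
  refine ⟨fun A => ?_, sum_mulVec_of_mem_doublyStochastic hD⟩
  let f : Matrix ι ι ℝ →ₗ[ℝ] ℝ :=
    { toFun := fun M => ∑ i ∈ A, (M *ᵥ w) i
      map_add' := fun M N => by simp [add_mulVec, sum_add_distrib]
      map_smul' := fun c M => by simp [smul_mulVec, mul_sum] }
  rw [← SetLike.mem_coe, doublyStochastic_eq_convexHull_permMatrix] at hD
  obtain ⟨_, ⟨σ, rfl⟩, hσ⟩ :=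
    (f.convexOn convex_univ).exists_ge_of_mem_convexHull (Set.subset_univ _) hD
  refine ⟨A.map σ.toEmbedding, by simp, hσ.trans_eq ?_⟩
  simp [f, permMatrix_mulVec]

theorem Matrix.IsHermitian.eq_sum_vecMulVec {ι : Type*} [Fintype ι] [DecidableEq ι]
    {A : Matrix ι ι ℂ} (hA : A.IsHermitian) :
    A = ∑ k, (hA.eigenvalues k : ℂ) •
      vecMulVec (⇑(hA.eigenvectorBasis k)) (star ⇑(hA.eigenvectorBasis k)) := by
  conv_lhs => rw [hA.spectral_theorem, Unitary.conjStarAlgAut_apply]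
  ext a b
  rw [mul_apply, Matrix.sum_apply]
  refine sum_congr rfl fun k _ => ?_
  simp [mul_diagonal, Matrix.star_apply, vecMulVec_apply]
  ring

theorem OrthonormalBasis.sum_vecMulVec_star {ι κ : Type*} [Fintype ι] [Fintype κ] [DecidableEq κ]
    (b : OrthonormalBasis ι ℂ (EuclideanSpace ℂ κ)) :
    ∑ k, vecMulVec (⇑(b k)) (star ⇑(b k)) = (1 : Matrix κ κ ℂ) := by
  ext x y
  have h := b.sum_inner_mul_inner (EuclideanSpace.single x 1) (EuclideanSpace.single y 1)
  simpa [Matrix.sum_apply, vecMulVec_apply, one_apply, EuclideanSpace.inner_single_left,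
    EuclideanSpace.inner_single_right, Pi.single_apply, eq_comm] using h

theorem OrthonormalBasis.sum_star_dotProduct_mulVec {ι κ : Type*} [Fintype ι] [Fintype κ]
    [DecidableEq κ] (b : OrthonormalBasis ι ℂ (EuclideanSpace ℂ κ)) (M : Matrix κ κ ℂ) :
    ∑ i, star ⇑(b i) ⬝ᵥ (M *ᵥ ⇑(b i)) = M.trace := by
  have h (i) : star ⇑(b i) ⬝ᵥ (M *ᵥ ⇑(b i)) = (M * vecMulVec ⇑(b i) (star ⇑(b i))).trace := by
    rw [mul_vecMulVec, trace_vecMulVec, dotProduct_comm]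
  simp_rw [h, ← trace_sum, ← Matrix.mul_sum, b.sum_vecMulVec_star, mul_one]

/-- A positive, unital, trace-preserving linear map sends a Hermitian matrix to one whose
spectrum is majorized by the original spectrum. -/
theorem Majorized.eigenvalues_map {ι : Type*} [Fintype ι] [DecidableEq ι]
    (Φ : Matrix ι ι ℂ →ₗ[ℂ] Matrix ι ι ℂ)
    (hpos : ∀ M : Matrix ι ι ℂ, M.PosSemidef → (Φ M).PosSemidef) (hone : Φ 1 = 1)
    (htr : ∀ M, (Φ M).trace = M.trace) {A : Matrix ι ι ℂ} (hA : A.IsHermitian)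
    (hΦA : (Φ A).IsHermitian) : Majorized hΦA.eigenvalues hA.eigenvalues := by
  set v := hA.eigenvectorBasis
  set w := hΦA.eigenvectorBasis
  let P (k : ι) : Matrix ι ι ℂ := vecMulVec ⇑(v k) (star ⇑(v k))
  let D : Matrix ι ι ℝ := of fun i k => (star ⇑(w i) ⬝ᵥ (Φ (P k) *ᵥ ⇑(w i))).re
  have hD : D ∈ doublyStochastic ℝ ι := by
    rw [mem_doublyStochastic_iff_sum]
    refine ⟨fun i k => ?_, fun i => ?_, fun k => ?_⟩
    · exact (hpos _ (posSemidef_vecMulVec_self_star _)).re_dotProduct_nonneg _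
    · have hw : star ⇑(w i) ⬝ᵥ ⇑(w i) = 1 := by
        rw [dotProduct_comm, ← EuclideanSpace.inner_eq_star_dotProduct]
        simp
      simp only [D, of_apply, ← Complex.re_sum, ← dotProduct_sum, ← sum_mulVec, ← map_sum, P]
      rw [v.sum_vecMulVec_star, hone, one_mulVec, hw, Complex.one_re]
    · have hv : ⇑(v k) ⬝ᵥ star ⇑(v k) = 1 := by
        rw [← EuclideanSpace.inner_eq_star_dotProduct]
        simp
      simp only [D, of_apply, ← Complex.re_sum]
      rw [w.sum_star_dotProduct_mulVec, htr, trace_vecMulVec, hv, Complex.one_re]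
  have hval : hΦA.eigenvalues = D *ᵥ hA.eigenvalues := by
    funext i
    have hsum : Φ A = ∑ k, (hA.eigenvalues k : ℂ) • Φ (P k) := by
      conv_lhs => rw [hA.eq_sum_vecMulVec, map_sum]
      simp only [map_smul, P, v]
    rw [hΦA.eigenvalues_eq]
    change (star ⇑(w i) ⬝ᵥ (Φ A *ᵥ ⇑(w i))).re = _
    rw [hsum, sum_mulVec, dotProduct_sum, Complex.re_sum, mulVec, dotProduct]
    refine sum_congr rfl fun k _ => ?_
    simp [D, smul_mulVec, mul_comm]
  rw [hval]
  exact .of_mulVec hD _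

/-- The three-fold convolution in closed form, as a sum of Hadamard products of translates. -/
def translateConv (A B C : Matrix G G ℂ) : Matrix G G ℂ :=
  ∑ s, ∑ t, A.submatrix (· + (s + t)) (· + (s + t)) ⊙
    (B.submatrix (· + t) (· + t) ⊙ C.submatrix (· + s) (· + s))

omit [DecidableEq G] in
theorem translateConv_apply (A B C : Matrix G G ℂ) (a b : G) :
    translateConv A B C a b = ∑ s, ∑ t, A (a + (s + t)) (b + (s + t)) *
      (B (a + t) (b + t) * C (a + s) (b + s)) := by
  simp [translateConv, Matrix.sum_apply]

omit [DecidableEq G] in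
theorem translateConv_comm_right (A B C : Matrix G G ℂ) :
    translateConv A B C = translateConv A C B := by
  ext a b
  rw [translateConv_apply, translateConv_apply, sum_comm]
  simp only [add_comm, mul_comm]

omit [DecidableEq G] in
theorem translateConv_comm_left (hG : ∀ x : G, x + x = 0) (A B C : Matrix G G ℂ) :
    translateConv A B C = translateConv B A C := by
  ext a b
  rw [translateConv_apply, translateConv_apply]
  refine sum_congr rfl fun s _ => Fintype.sum_equiv (Equiv.addLeft s) _ _ fun t => ?_
  have h : s + (s + t) = t := by rw [← add_assoc, hG, zero_add]
  simp only [Equiv.coe_addLeft, h]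
  ring

/-- The convolution with two fixed matrices, as a linear map of the first argument. -/
def translateConvLinear (B C : Matrix G G ℂ) : Matrix G G ℂ →ₗ[ℂ] Matrix G G ℂ where
  toFun A := translateConv A B C
  map_add' A A' := by
    ext a b
    simp [translateConv_apply, add_mul, sum_add_distrib]
  map_smul' c A := by
    ext a b
    simp [translateConv_apply, mul_sum, mul_assoc]

omit [DecidableEq G] in
theorem Matrix.PosSemidef.translateConv {A B C : Matrix G G ℂ} (hA : A.PosSemidef)
    (hB : B.PosSemidef) (hC : C.PosSemidef) : (translateConv A B C).PosSemidef :=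
  posSemidef_sum _ fun _ _ => posSemidef_sum _ fun _ _ =>
    (hA.submatrix _).hadamard ((hB.submatrix _).hadamard (hC.submatrix _))

omit [DecidableEq G] in
theorem sum_translate_eq_trace (M : Matrix G G ℂ) (x : G) :
    ∑ s, M (x + s) (x + s) = M.trace :=
  Fintype.sum_equiv (Equiv.addLeft x) _ _ fun _ => rfl

omit [DecidableEq G] in
theorem trace_translateConv (hG : ∀ x : G, x + x = 0) (A B C : Matrix G G ℂ) :
    (translateConv A B C).trace = A.trace * (B.trace * C.trace) := by
  calc (translateConv A B C).trace
    _ = ∑ s, ∑ t, ∑ a, A (a + (s + t)) (a + (s + t)) * (B (a + t) (a + t) * C (a + s) (a + s)) := by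
      simp only [trace, diag_apply, translateConv_apply]
      rw [sum_comm]
      exact sum_congr rfl fun _ _ => sum_comm
    _ = ∑ s, ∑ t, ∑ x, A x x * (B (x + s) (x + s) * C (x + t) (x + t)) := by
      refine sum_congr rfl fun s _ => sum_congr rfl fun t _ =>
        Fintype.sum_equiv (Equiv.addRight (s + t)) _ _ fun a => ?_
      have hs : a + (s + t) + s = a + t := by
        rw [show a + (s + t) + s = a + t + (s + s) by abel, hG, add_zero]
      have ht : a + (s + t) + t = a + s := by
        rw [show a + (s + t) + t = a + s + (t + t) by abel, hG, add_zero]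
      simp only [Equiv.coe_addRight, hs, ht]
    _ = ∑ x, A x x * ((∑ s, B (x + s) (x + s)) * ∑ t, C (x + t) (x + t)) := by
      simp_rw [sum_mul_sum, mul_sum]
      exact sum_comm_cycle
    _ = A.trace * (B.trace * C.trace) := by
      simp only [sum_translate_eq_trace, ← sum_mul]
      rfl

theorem translateConv_one_left (B C : Matrix G G ℂ) (hB : B.trace = 1) (hC : C.trace = 1) :
    translateConv 1 B C = 1 := by
  ext a b
  rw [translateConv_apply]
  by_cases hab : a = b
  · subst hab
    simp [← sum_mul, sum_translate_eq_trace, hB, hC]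
  · simp [one_apply, hab]

/-- The inverse of the key permutation on three registers of exponent two. -/
def keyInv (x : Fin 3 → G) : Fin 3 → G :=
  ![x 0 + (x 1 + x 2), x 0 + x 2, x 0 + x 1]

omit [Fintype G] [DecidableEq G] in
theorem eq_keyFun_iff (hG : ∀ x : G, x + x = 0) (x y : Fin 3 → G) :
    x = keyFun 2 y ↔ y = keyInv x := by
  have hcancel (g h : G) : g + (g + h) = h := by rw [← add_assoc, hG, zero_add]
  constructor
  · rintro rfl
    funext i
    fin_cases i <;> simp [keyFun, keyInv, Fin.sum_univ_three, add_comm, add_left_comm, hG, hcancel]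
  · rintro rfl
    funext i
    fin_cases i <;> simp [keyFun, keyInv, Fin.sum_univ_three, add_assoc, add_left_comm, hG, hcancel,
      add_comm (x 1) (x 0)]

theorem keyU_conj (hG : ∀ x : G, x + x = 0)
    (M : Matrix (Fin (2 + 1) → G) (Fin (2 + 1) → G) ℂ) :
    keyU 2 * M * (keyU 2)ᴴ = M.submatrix keyInv keyInv := by
  ext x y
  simp [mul_apply, keyU, eq_keyFun_iff hG]

/-- Functions on the two registers that are traced out, as pairs. -/
def tracedEquiv (G : Type*) : ({i : Fin 3 // i ≠ 0} → G) ≃ G × G where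
  toFun r := (r ⟨1, by decide⟩, r ⟨2, by decide⟩)
  invFun p i := if i.1 = 1 then p.1 else p.2
  left_inv r := by
    funext ⟨i, hi⟩
    fin_cases i
    · exact absurd rfl hi
    · rfl
    · rfl
  right_inv p := by simp

theorem qconv_eq_translateConv (hG : ∀ x : G, x + x = 0) (ρ : Fin 3 → Matrix G G ℂ) :
    qconv 2 ρ = translateConv (ρ 0) (ρ 1) (ρ 2) := by
  ext a b
  rw [translateConv_apply, ← Fintype.sum_prod_type', qconv, keyU_conj hG, ptraceFirst,
    of_apply]
  refine Fintype.sum_equiv (tracedEquiv G) _ _ fun r => ?_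
  simp [bigTensor, Fin.prod_univ_three, keyInv, tracedEquiv]
  ring

/-- **Majorization under convolution:** the spectrum of `⊠₃(ρ₁⊗ρ₂⊗ρ₃)` is
majorized by the spectrum of each `ρⱼ`. -/
theorem qconv_majorization (n : ℕ)
    (ρ : Fin 3 → Matrix (Fin n → ZMod 2) (Fin n → ZMod 2) ℂ)
    (hρ : ∀ i, IsState (ρ i))
    (hconv : (qconv 2 ρ).IsHermitian) (j : Fin 3) :
    Majorized hconv.eigenvalues ((hρ j).1.isHermitian.eigenvalues) := by
  have hG (x : Fin n → ZMod 2) : x + x = 0 := by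
    funext i
    exact CharTwo.add_self_eq_zero _
  obtain ⟨B, C, hB, hC, h⟩ : ∃ B C : Matrix (Fin n → ZMod 2) (Fin n → ZMod 2) ℂ,
      IsState B ∧ IsState C ∧ qconv 2 ρ = translateConv (ρ j) B C := by
    rw [qconv_eq_translateConv hG]
    fin_cases j
    · exact ⟨_, _, hρ 1, hρ 2, rfl⟩
    · exact ⟨_, _, hρ 0, hρ 2, translateConv_comm_left hG _ _ _⟩
    · refine ⟨_, _, hρ 0, hρ 1, ?_⟩
      rw [translateConv_comm_right, translateConv_comm_left hG]
      rfl
  generalize qconv 2 ρ = Q at h hconv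
  subst h
  refine Majorized.eigenvalues_map (translateConvLinear B C)
    (fun M hM => hM.translateConv hB.1 hC.1) (translateConv_one_left B C hB.2 hC.2)
    (fun M => ?_) _ hconv
  exact (trace_translateConv hG M B C).trans (by rw [hB.2, hC.2, mul_one, mul_one])
end
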